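/- Let f̄ : ℝⁿ → ℝⁿ be globally Lipschitz with flow φ and let β > 0. Let μ, μ_0, μ_T be finite compactly supported nonnegative Borel measures on ℝⁿ satisfying the discounted Liouville equation ∫ v dμ_T = ∫ v dμ_0 + ∫ ( ∇v·f̄ − β v ) dμ for every continuously differentiable v : ℝⁿ → ℝ. Then there exists a Markov kernel x_0 ↦ τ_{x_0} assigning to μ_0-almost every x_0 ∈ ℝⁿ a Borel probability measure τ_{x_0} on the extended half-line [0, ∞] such that for every bounded continuous v : ℝⁿ → ℝ: (i) ∫_{ℝⁿ} v dμ = ∫_{ℝⁿ} ∫_{[0,∞]} ( ∫_0^{τ} e^{−βt} v(φ(t, x_0)) dt ) dτ_{x_0}(τ) dμ_0(x_0), and (ii) ∫_{ℝⁿ} v dμ_T = ∫_{ℝⁿ} ∫_{[0,∞)} e^{−βτ} v(φ(τ, x_0)) dτ_{x_0}(τ) dμ_0(x_0), where in (ii) the inner integration is over the finite values of τ only (equivalently, e^{−β·∞} := 0). (Superposition theorem: any solution of the discounted Liouville equation is generated by a superposition, over stopping times, of trajectories of ẋ = f̄(x).) -/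

import Mathlib

open MeasureTheory Set ProbabilityTheory

/-- Properties of the flow (extended by the identity to negative times). -/
structure FlowProps {n : ℕ} (f : (Fin n → ℝ) → (Fin n → ℝ)) (K : NNReal)
    (ψ : ℝ → (Fin n → ℝ) → (Fin n → ℝ)) : Prop where
  lipf : LipschitzWith K f
  zero : ∀ x, ψ 0 x = x
  deriv : ∀ x, ∀ t ∈ Ici (0:ℝ), HasDerivWithinAt (fun s => ψ s x) (f (ψ t x)) (Ici 0) t
  dist_le : ∀ t, 0 ≤ t → ∀ x y, dist (ψ t x) (ψ t y) ≤ dist x y * Real.exp (K * t)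
  add : ∀ s t, 0 ≤ s → 0 ≤ t → ∀ x, ψ (s + t) x = ψ s (ψ t x)
  cont : Continuous (fun p : ℝ × (Fin n → ℝ) => ψ p.1 p.2)

theorem flowProps_of {n : ℕ}
    (f : (Fin n → ℝ) → (Fin n → ℝ)) (K : NNReal) (hf : LipschitzWith K f)
    (φ : ℝ → (Fin n → ℝ) → (Fin n → ℝ))
    (hφ0 : ∀ x, φ 0 x = x)
    (hφ : ∀ x, ∀ t ∈ Ici (0:ℝ), HasDerivWithinAt (fun s => φ s x) (f (φ t x)) (Ici 0) t) :
    FlowProps f K (fun t x => φ (max t 0) x) := by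
  have hco : ∀ x, ContinuousOn (fun s => φ s x) (Ici 0) := fun x t ht =>
    (hφ x t ht).continuousWithinAt
  have hd : ∀ x, ∀ t, 0 ≤ t → HasDerivWithinAt (fun s => φ s x) (f (φ t x)) (Ici t) t :=
    fun x t ht => (hφ x t ht).mono (Ici_subset_Ici.2 ht)
  have hdist : ∀ t, 0 ≤ t → ∀ x y, dist (φ t x) (φ t y) ≤ dist x y * Real.exp (K * t) := by
    intro t ht x y
    have := dist_le_of_trajectories_ODE (v := fun _ => f) (K := K) (a := 0) (b := t)
      (f := fun s => φ s x) (g := fun s => φ s y) (δ := dist x y) (fun _ => hf)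
      ((hco x).mono Icc_subset_Ici_self) (fun s hs => hd x s hs.1)
      ((hco y).mono Icc_subset_Ici_self) (fun s hs => hd y s hs.1) (by simp [hφ0]) t ⟨ht, le_rfl⟩
    simpa using this
  refine ⟨hf, fun x => by simp [hφ0], ?_, ?_, ?_, ?_⟩
  · intro x t ht
    have ht' : (0:ℝ) ≤ t := ht
    have := hφ x t ht
    simp only [max_eq_left ht']
    refine this.congr (fun s hs => ?_) ?_
    · simp only [mem_Ici] at hs; simp [max_eq_left hs]
    · simp [max_eq_left ht']
  · intro t ht x y
    simpa [max_eq_left ht] using hdist t ht x y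
  · intro s t hs ht x
    simp only [max_eq_left hs, max_eq_left ht, max_eq_left (add_nonneg hs ht)]
    have := ODE_solution_unique (v := fun _ => f) (K := K) (a := 0) (b := s)
      (f := fun s => φ (s + t) x) (g := fun s => φ s (φ t x)) (fun _ => hf)
      ((hco x).comp (by fun_prop) (fun r hr => by
        simp only [mem_Icc, mem_Ici] at *; linarith))
      (fun r hr => by
        have h1 := hd x (r + t) (add_nonneg hr.1 ht)
        have := h1.scomp (h := fun r => r + t) (t' := Ici (r+t)) (s := Ici r) r
          (((hasDerivAt_id r).add_const t).hasDerivWithinAt) (fun u hu => by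
            simp only [mem_Ici] at *; linarith)
        simpa [Function.comp_def] using this)
      ((hco _).mono Icc_subset_Ici_self) (fun r hr => hd _ r hr.1) (by simp [hφ0])
    exact this ⟨hs, le_rfl⟩
  · refine continuous_iff_continuousAt.2 ?_
    rintro ⟨t, x⟩
    rw [ContinuousAt, tendsto_iff_dist_tendsto_zero]
    have hc1 : Continuous (fun s : ℝ => φ (max s 0) x) :=
      (hco x).comp_continuous (by fun_prop) (fun s => mem_Ici.2 (le_max_right _ _))
    have hb : Filter.Tendsto (fun p : ℝ × (Fin n → ℝ) =>
        dist p.2 x * Real.exp (K * (max p.1 0)) + dist (φ (max p.1 0) x) (φ (max t 0) x))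
        (nhds (t, x)) (nhds 0) := by
      have : Continuous (fun p : ℝ × (Fin n → ℝ) =>
        dist p.2 x * Real.exp (K * (max p.1 0)) + dist (φ (max p.1 0) x) (φ (max t 0) x)) := by
        have := hc1.comp (continuous_fst (X := ℝ) (Y := Fin n → ℝ))
        exact (by fun_prop : Continuous (fun p : ℝ × (Fin n → ℝ) =>
          dist p.2 x * Real.exp (K * (max p.1 0)))).add (this.dist continuous_const)
      have h2 := this.tendsto (t, x)
      simpa using h2
    refine squeeze_zero (fun _ => dist_nonneg) (fun p => ?_) hb
    refine (dist_triangle _ (φ (max p.1 0) x) _).trans ?_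
    gcongr
    exact hdist _ (le_max_right _ _) _ _

/-- Mollification estimate and the extension of the Liouville equation to Lipschitz functions
that are differentiable along the flow. -/
theorem mollify_bound {n : ℕ} {f : (Fin n → ℝ) → (Fin n → ℝ)} {K : NNReal}
    {ψ : ℝ → (Fin n → ℝ) → (Fin n → ℝ)} (hψ : FlowProps f K ψ)
    (w g : (Fin n → ℝ) → ℝ) (L L' : NNReal) (hw : LipschitzWith L w) (hg : LipschitzWith L' g)
    (hwg : ∀ x, ∀ t ∈ Ici (0:ℝ), HasDerivWithinAt (fun s => w (ψ s x)) (g (ψ t x)) (Ici 0) t)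
    (ε : ℝ) (hε : 0 < ε) :
    ∃ G : (Fin n → ℝ) → ℝ, ContDiff ℝ 1 G ∧ (∀ x, |G x - w x| ≤ L * ε) ∧
      ∀ x, |fderiv ℝ G x (f x) - g x| ≤ (L * K + L') * (3 * ε) := by
  let ρ : ContDiffBump (0 : Fin n → ℝ) := ⟨ε / 2, ε, by positivity, by linarith⟩
  let G := convolution (ρ.normed volume) w (ContinuousLinearMap.lsmul ℝ ℝ) volume
  have hG : ContDiff ℝ 1 G := by
    refine HasCompactSupport.contDiff_convolution_left (n := 1) _ ρ.hasCompactSupport_normed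
      ρ.contDiff_normed hw.continuous.locallyIntegrable
  refine ⟨G, hG, ?_, ?_⟩
  · intro x
    have := ρ.dist_normed_convolution_le (μ := volume) (g := w) (x₀ := x) (ε := L * ε)
      hw.continuous.aestronglyMeasurable (fun y hy => (hw.dist_le_mul y x).trans (by
        have : dist y x < ε := hy
        gcongr))
    exact this
  · intro x
    -- eventually estimate
    have hev : ∀ᶠ s in nhdsWithin (0:ℝ) (Ioi 0),
        |s⁻¹ * (G (x + s • f x) - G x) - g x| ≤ (L * K + L') * (3 * ε) := by
      have hc : Continuous (fun r : ℝ => ε * Real.exp (K * r) + dist (ψ r x) x) := by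
        have := hψ.cont.comp (Continuous.prodMk_left x)
        simp only [Function.comp_def] at this
        fun_prop
      have h1 : ∀ᶠ r in nhds (0:ℝ), ε * Real.exp (K * r) + dist (ψ r x) x < 3 * ε := by
        refine (hc.tendsto 0).eventually (gt_mem_nhds ?_)
        simp [hψ.zero]; linarith
      obtain ⟨δ, hδ, h2⟩ := Metric.eventually_nhds_iff.1 h1
      have h3 : ∀ᶠ s in nhdsWithin (0:ℝ) (Ioi 0), s < δ :=
        mem_nhdsWithin_of_mem_nhds (gt_mem_nhds hδ)
      filter_upwards [h3, self_mem_nhdsWithin] with s hs hs0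
      have hs0 : 0 < s := hs0
      have hclose : ∀ z ∈ Metric.ball x ε, ∀ r ∈ Icc 0 s, dist (ψ r z) x ≤ 3 * ε := by
        intro z hz r hr
        have h4 := h2 (y := r) (by
          rw [Real.dist_eq, sub_zero, abs_of_nonneg hr.1]; linarith [hr.2])
        have h5 := hψ.dist_le r hr.1 z x
        have h6 : dist z x * Real.exp (K * r) ≤ ε * Real.exp (K * r) := by
          have : dist z x < ε := hz
          gcongr
        linarith [dist_triangle (ψ r z) (ψ r x) x]
      have hf1 : ∀ z ∈ Metric.ball x ε, ‖ψ s z - (z + s • f x)‖ ≤ K * (3 * ε) * s := by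
        intro z hz
        have := norm_image_sub_le_of_norm_deriv_le_segment'
          (f := fun r => ψ r z - r • f x) (f' := fun r => f (ψ r z) - f x)
          (a := 0) (b := s) (C := K * (3 * ε)) (fun r hr => by
            have h7 := ((hψ.deriv z r hr.1).mono (Icc_subset_Ici_self : Icc 0 s ⊆ Ici 0))
            have h8 := ((hasDerivAt_id r).smul_const (f x)).hasDerivWithinAt (s := Icc 0 s)
            simpa using h7.fun_sub h8) (fun r hr => by
            rw [← dist_eq_norm]
            refine (hψ.lipf.dist_le_mul _ _).trans ?_
            gcongr
            exact hclose z hz r ⟨hr.1, hr.2.le⟩) s ⟨hs0.le, le_rfl⟩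
        simp only [hψ.zero, zero_smul, sub_zero] at this
        have e : ψ s z - (z + s • f x) = ψ s z - s • f x - z := by abel
        rw [e]; exact this
      have hg1 : ∀ z ∈ Metric.ball x ε, ‖w (ψ s z) - w z - s * g x‖ ≤ L' * (3 * ε) * s := by
        intro z hz
        have := norm_image_sub_le_of_norm_deriv_le_segment'
          (f := fun r => w (ψ r z) - r • g x) (f' := fun r => g (ψ r z) - g x)
          (a := 0) (b := s) (C := L' * (3 * ε)) (fun r hr => by
            have h7 := ((hwg z r hr.1).mono (Icc_subset_Ici_self : Icc 0 s ⊆ Ici 0))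
            have h8 := ((hasDerivAt_id r).smul_const (g x)).hasDerivWithinAt (s := Icc 0 s)
            simpa using h7.fun_sub h8) (fun r hr => by
            rw [← dist_eq_norm]
            refine (hg.dist_le_mul _ _).trans ?_
            gcongr
            exact hclose z hz r ⟨hr.1, hr.2.le⟩) s ⟨hs0.le, le_rfl⟩
        simp only [hψ.zero, zero_mul, sub_zero, smul_eq_mul] at this
        have e : w (ψ s z) - w z - s * g x = w (ψ s z) - s * g x - w z := by abel
        rw [e]; exact this
      have hcv : dist (convolution (ρ.normed volume) (fun z => w (z + s • f x) - w z)
          (ContinuousLinearMap.lsmul ℝ ℝ) volume x) (s * g x) ≤ (L * K + L') * (3 * ε) * s := by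
        refine dist_convolution_le (R := ε) (by positivity) ρ.support_normed_eq.subset ρ.nonneg_normed
          ρ.integral_normed ?_ ?_
        · exact ((hw.continuous.comp (by fun_prop)).sub hw.continuous).aestronglyMeasurable
        · intro z hz
          have h1 := hf1 z hz
          have h2 := hg1 z hz
          have h3 := hw.dist_le_mul (ψ s z) (z + s • f x)
          rw [dist_eq_norm (ψ s z)] at h3
          have h4 : (L:ℝ) * ‖ψ s z - (z + s • f x)‖ ≤ L * (K * (3 * ε) * s) := by gcongr
          rw [Real.dist_eq] at h3 ⊢
          rw [Real.norm_eq_abs] at h2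
          have h5 := h3.trans h4
          rw [abs_le] at *
          constructor <;> nlinarith [h2.1, h2.2, h5.1, h5.2]
      have heq : convolution (ρ.normed volume) (fun z => w (z + s • f x) - w z)
          (ContinuousLinearMap.lsmul ℝ ℝ) volume x = G (x + s • f x) - G x := by
        simp only [G, convolution]
        rw [← integral_sub]
        · congr 1
          ext t
          simp only [ContinuousLinearMap.lsmul_apply, smul_eq_mul, ← mul_sub]
          congr 3
          abel
        · exact ((ρ.hasCompactSupport_normed.convolutionExists_left _ ρ.continuous_normed
            hw.continuous.locallyIntegrable) (x + s • f x))
        · exact ((ρ.hasCompactSupport_normed.convolutionExists_left _ ρ.continuous_normed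
            hw.continuous.locallyIntegrable) x)
      rw [heq, Real.dist_eq] at hcv
      have : s⁻¹ * (G (x + s • f x) - G x) - g x = s⁻¹ * (G (x + s • f x) - G x - s * g x) := by
        field_simp
      rw [this, abs_mul, abs_of_pos (inv_pos.2 hs0)]
      calc _ ≤ s⁻¹ * ((L * K + L') * (3 * ε) * s) := by gcongr
        _ = _ := by field_simp
    have hlim : Filter.Tendsto (fun s : ℝ => s⁻¹ * (G (x + s • f x) - G x))
        (nhdsWithin (0:ℝ) (Ioi 0)) (nhds (fderiv ℝ G x (f x))) := by
      have hG1 : HasFDerivAt G (fderiv ℝ G x) x := (hG.differentiable (by norm_num) x).hasFDerivAt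
      have := (hG1.hasLineDerivAt (f x)).tendsto_slope_zero_right
      simpa using this
    exact le_of_tendsto ((hlim.sub_const _).abs) hev

theorem integrable_of_cpt {X : Type*} [TopologicalSpace X] [T2Space X] [MeasurableSpace X] [BorelSpace X]
    {μ : Measure X} [IsFiniteMeasure μ]
    (hμc : ∃ C : Set X, IsCompact C ∧ μ Cᶜ = 0) {h : X → ℝ} (hh : Continuous h) :
    Integrable h μ := by
  obtain ⟨C, hC, h0⟩ := hμc
  have : μ.restrict C = μ := Measure.restrict_eq_self_of_ae_mem (by
    rw [ae_iff]; exact h0)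
  rw [← this]
  exact hh.continuousOn.integrableOn_compact hC

/-- The Liouville equation extends to Lipschitz functions differentiable along the flow. -/
theorem liouville_ext {n : ℕ} {f : (Fin n → ℝ) → (Fin n → ℝ)} {K : NNReal}
    {ψ : ℝ → (Fin n → ℝ) → (Fin n → ℝ)} (hψ : FlowProps f K ψ)
    (β : ℝ)
    (μ μ₀ μT : Measure (Fin n → ℝ))
    [IsFiniteMeasure μ] [IsFiniteMeasure μ₀] [IsFiniteMeasure μT]
    (hμc : ∃ C : Set (Fin n → ℝ), IsCompact C ∧ μ Cᶜ = 0)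
    (hμ₀c : ∃ C : Set (Fin n → ℝ), IsCompact C ∧ μ₀ Cᶜ = 0)
    (hμTc : ∃ C : Set (Fin n → ℝ), IsCompact C ∧ μT Cᶜ = 0)
    (hLiouville : ∀ v : (Fin n → ℝ) → ℝ, ContDiff ℝ 1 v →
      ∫ x, v x ∂μT = (∫ x, v x ∂μ₀) + ∫ x, (fderiv ℝ v x (f x) - β * v x) ∂μ)
    (w g : (Fin n → ℝ) → ℝ) (L L' : NNReal) (hw : LipschitzWith L w) (hg : LipschitzWith L' g)
    (hwg : ∀ x, ∀ t ∈ Ici (0:ℝ), HasDerivWithinAt (fun s => w (ψ s x)) (g (ψ t x)) (Ici 0) t) :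
    ∫ x, w x ∂μT = (∫ x, w x ∂μ₀) + ∫ x, (g x - β * w x) ∂μ := by
  set A := ∫ x, w x ∂μT - ((∫ x, w x ∂μ₀) + ∫ x, (g x - β * w x) ∂μ) with hA
  suffices hA0 : A = 0 by linarith
  set M : ℝ := L * μT.real univ + L * μ₀.real univ
    + ((L * K + L') * 3 + |β| * L) * μ.real univ with hM
  have hM0 : 0 ≤ M := by positivity
  have key : ∀ ε : ℝ, 0 < ε → |A| ≤ M * ε := by
    intro ε hε
    obtain ⟨G, hG, h1, h2⟩ := mollify_bound hψ w g L L' hw hg hwg ε hε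
    have hGc := hG.continuous
    have hGd : Continuous (fun x => fderiv ℝ G x (f x)) :=
      (hG.continuous_fderiv (by norm_num)).clm_apply hψ.lipf.continuous
    have e := hLiouville G hG
    have eT : ∫ x, (G x - w x) ∂μT = ∫ x, G x ∂μT - ∫ x, w x ∂μT :=
      integral_sub (integrable_of_cpt hμTc hGc) (integrable_of_cpt hμTc hw.continuous)
    have e0 : ∫ x, (G x - w x) ∂μ₀ = ∫ x, G x ∂μ₀ - ∫ x, w x ∂μ₀ :=
      integral_sub (integrable_of_cpt hμ₀c hGc) (integrable_of_cpt hμ₀c hw.continuous)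
    have e1 : ∫ x, ((fderiv ℝ G x (f x) - β * G x) - (g x - β * w x)) ∂μ
        = ∫ x, (fderiv ℝ G x (f x) - β * G x) ∂μ - ∫ x, (g x - β * w x) ∂μ :=
      integral_sub (integrable_of_cpt hμc (hGd.sub (continuous_const.mul hGc)))
        (integrable_of_cpt hμc (hg.continuous.sub (continuous_const.mul hw.continuous)))
    have bT := norm_integral_le_of_norm_le_const (μ := μT) (f := fun x => G x - w x) (C := L * ε)
      (Filter.Eventually.of_forall (fun x => h1 x))
    have b0 := norm_integral_le_of_norm_le_const (μ := μ₀) (f := fun x => G x - w x) (C := L * ε)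
      (Filter.Eventually.of_forall (fun x => h1 x))
    have b1 := norm_integral_le_of_norm_le_const (μ := μ)
      (f := fun x => (fderiv ℝ G x (f x) - β * G x) - (g x - β * w x))
      (C := ((L * K + L') * 3 + |β| * L) * ε) (Filter.Eventually.of_forall
      (fun x => by
        have h3 : |β * (G x - w x)| ≤ |β| * (L * ε) := by
          rw [abs_mul]; gcongr; exact h1 x
        have h4 := h2 x
        rw [Real.norm_eq_abs]
        rw [abs_le] at *
        constructor <;> nlinarith [h3.1, h3.2, h4.1, h4.2]))
    rw [eT, Real.norm_eq_abs] at bT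
    rw [e0, Real.norm_eq_abs] at b0
    rw [e1, Real.norm_eq_abs] at b1
    rw [hA, hM]
    rw [abs_le] at *
    constructor <;> nlinarith [bT.1, bT.2, b0.1, b0.2, b1.1, b1.2]
  by_contra hne
  have hpos : 0 < |A| := abs_pos.2 hne
  have := key (|A| / (2 * (M + 1))) (by positivity)
  have h3 : M * (|A| / (2 * (M + 1))) < |A| := by
    rw [mul_div_assoc', div_lt_iff₀ (by positivity)]
    nlinarith
  linarith

theorem liouville_finite {n : ℕ} {f : (Fin n → ℝ) → (Fin n → ℝ)} {K : NNReal}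
    {ψ : ℝ → (Fin n → ℝ) → (Fin n → ℝ)} (hψ : FlowProps f K ψ)
    (β : ℝ) (hβ : 0 < β)
    (μ μ₀ μT : Measure (Fin n → ℝ))
    [IsFiniteMeasure μ] [IsFiniteMeasure μ₀] [IsFiniteMeasure μT]
    (hμc : ∃ C : Set (Fin n → ℝ), IsCompact C ∧ μ Cᶜ = 0)
    (hμ₀c : ∃ C : Set (Fin n → ℝ), IsCompact C ∧ μ₀ Cᶜ = 0)
    (hμTc : ∃ C : Set (Fin n → ℝ), IsCompact C ∧ μT Cᶜ = 0)
    (hLiouville : ∀ v : (Fin n → ℝ) → ℝ, ContDiff ℝ 1 v →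
      ∫ x, v x ∂μT = (∫ x, v x ∂μ₀) + ∫ x, (fderiv ℝ v x (f x) - β * v x) ∂μ)
    (u : (Fin n → ℝ) → ℝ) (L : NNReal) (hu : LipschitzWith L u) (T : ℝ) (hT : 0 ≤ T) :
    ∫ x, (∫ t in (0:ℝ)..T, Real.exp (-β * t) * u (ψ t x)) ∂μT =
     (∫ x, (∫ t in (0:ℝ)..T, Real.exp (-β * t) * u (ψ t x)) ∂μ₀) +
      ∫ x, (Real.exp (-β * T) * u (ψ T x) - u x) ∂μ := by
  set w : (Fin n → ℝ) → ℝ := fun x => ∫ t in (0:ℝ)..T, Real.exp (-β * t) * u (ψ t x) with hwdef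
  have hcx : ∀ x, Continuous (fun t => Real.exp (-β * t) * u (ψ t x)) := fun x => by
    have h1 := hu.continuous.comp (hψ.cont.comp (Continuous.prodMk_left x))
    exact (by fun_prop : Continuous fun t => Real.exp (-β * t)).mul h1
  have hlipψ : LipschitzWith (Real.exp (K * T)).toNNReal (ψ T) := by
    refine LipschitzWith.of_dist_le_mul (fun x y => ?_)
    rw [Real.coe_toNNReal _ (Real.exp_pos _).le, mul_comm]
    exact hψ.dist_le T hT x y
  have hw : LipschitzWith (L * Real.exp (K * T) * T).toNNReal w := by
    refine LipschitzWith.of_dist_le_mul (fun x y => ?_)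
    rw [Real.coe_toNNReal _ (by positivity), Real.dist_eq, hwdef]
    simp only
    rw [← intervalIntegral.integral_sub ((hcx x).intervalIntegrable _ _)
      ((hcx y).intervalIntegrable _ _)]
    have := intervalIntegral.norm_integral_le_of_norm_le_const (a := 0) (b := T)
      (f := fun t => Real.exp (-β * t) * u (ψ t x) - Real.exp (-β * t) * u (ψ t y))
      (C := L * Real.exp (K * T) * dist x y) (fun t ht => by
        rw [uIoc_of_le hT] at ht
        rw [← mul_sub, norm_mul, Real.norm_eq_abs, Real.norm_eq_abs, ← Real.dist_eq,
          abs_of_pos (Real.exp_pos _)]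
        have h1 : Real.exp (-β * t) ≤ 1 := Real.exp_le_one_iff.2 (by nlinarith [ht.1])
        have h2 := hu.dist_le_mul (ψ t x) (ψ t y)
        have h3 := hψ.dist_le t ht.1.le x y
        calc _ ≤ 1 * (L * (dist x y * Real.exp (K * T))) := by
              gcongr
              refine h2.trans ?_
              gcongr
              refine h3.trans ?_
              gcongr
              exact ht.2
          _ = _ := by ring)
    rw [sub_zero, abs_of_nonneg hT] at this
    rw [Real.norm_eq_abs] at this
    linarith
  obtain ⟨L', hL'⟩ : ∃ L', LipschitzWith L'
      (fun x => β * w x + (Real.exp (-β * T) * u (ψ T x) - u x)) :=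
    ⟨_, ((lipschitzWith_smul β).comp hw).add
      ((((lipschitzWith_smul (Real.exp (-β * T))).comp (hu.comp hlipψ))).sub hu)⟩
  have hder : ∀ x, ∀ t ∈ Ici (0:ℝ), HasDerivWithinAt (fun s => w (ψ s x))
      (β * w (ψ t x) + (Real.exp (-β * T) * u (ψ T (ψ t x)) - u (ψ t x))) (Ici 0) t := by
    intro x t ht
    set h : ℝ → ℝ := fun t => Real.exp (-β * t) * u (ψ t x) with hh
    have hww : ∀ s ∈ Ici (0:ℝ), w (ψ s x) =
        Real.exp (β * s) * ((∫ r in (0:ℝ)..(T + s), h r) - ∫ r in (0:ℝ)..s, h r) := by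
      intro s hs
      have hs : 0 ≤ s := hs
      rw [intervalIntegral.integral_interval_sub_left ((hcx x).intervalIntegrable _ _)
        ((hcx x).intervalIntegrable _ _)]
      have : ∫ r in s..(T + s), h r = ∫ r in (0:ℝ)..T, h (r + s) := by
        rw [intervalIntegral.integral_comp_add_right, zero_add]
      rw [this, ← intervalIntegral.integral_const_mul]
      refine intervalIntegral.integral_congr (fun r hr => ?_)
      rw [uIcc_of_le hT] at hr
      simp only [hh]
      rw [hψ.add r s hr.1 hs, ← mul_assoc, ← Real.exp_add]
      congr 2
      ring
    have d1 : HasDerivAt (fun s => ∫ r in (0:ℝ)..s, h r) (h t) t :=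
      intervalIntegral.integral_hasDerivAt_right ((hcx x).intervalIntegrable _ _)
        ((hcx x).stronglyMeasurableAtFilter _ _) (hcx x).continuousAt
    have d2 : HasDerivAt (fun s => ∫ r in (0:ℝ)..(T + s), h r) (h (T + t)) t := by
      have : HasDerivAt (fun s => ∫ r in (0:ℝ)..s, h r) (h (T + t)) (T + t) :=
        intervalIntegral.integral_hasDerivAt_right ((hcx x).intervalIntegrable _ _)
        ((hcx x).stronglyMeasurableAtFilter _ _) (hcx x).continuousAt
      exact this.comp_const_add T t
    have d3 : HasDerivAt (fun s => Real.exp (β * s)) (Real.exp (β * t) * β) t := by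
      simpa using ((hasDerivAt_id t).const_mul β).exp
    have d4 := (d3.fun_mul (d2.fun_sub d1)).hasDerivWithinAt (s := Ici 0)
    refine (d4.congr hww (hww t ht)).congr_deriv ?_
    rw [hww t ht, ← hψ.add T t hT ht]
    simp only [hh]
    have x1 : Real.exp (β * t) * Real.exp (-β * (T + t)) = Real.exp (-β * T) := by
      rw [← Real.exp_add]; congr 1; ring
    have x2 : Real.exp (β * t) * Real.exp (-β * t) = 1 := by
      rw [← Real.exp_add]; simp
    linear_combination u (ψ (T + t) x) * x1 - u (ψ t x) * x2
  have := liouville_ext hψ β μ μ₀ μT hμc hμ₀c hμTc hLiouville w _ _ L' hw hL' hder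
  rw [this]
  congr 2
  ext x
  ring

/-- the discount measure -/
noncomputable def discM (β : ℝ) : Measure ℝ :=
  (volume.restrict (Ici 0)).withDensity (fun t => ENNReal.ofReal (Real.exp (-β * t)))

theorem integral_discM (β : ℝ) (g : ℝ → ℝ) :
    ∫ t, g t ∂(discM β) = ∫ t in Ici 0, Real.exp (-β * t) * g t := by
  rw [discM, integral_withDensity_eq_integral_toReal_smul (by fun_prop) (by simp)]
  simp [ENNReal.toReal_ofReal, Real.exp_nonneg]

theorem isFinite_discM {β : ℝ} (hβ : 0 < β) : IsFiniteMeasure (discM β) := by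
  refine isFiniteMeasure_withDensity_ofReal ?_
  have := (integrableOn_exp_mul_Ioi (a := -β) (by linarith) 0)
  exact ((integrableOn_Ici_iff_integrableOn_Ioi (μ := volume)).2 this).2

/-- resolvent -/
noncomputable def resolv {X : Type*} (β : ℝ) (ψ : ℝ → X → X) (u : X → ℝ) (x : X) : ℝ :=
  ∫ t, u (ψ t x) ∂(discM β)

theorem resolv_cont {n : ℕ} {f : (Fin n → ℝ) → (Fin n → ℝ)} {K : NNReal}
    {ψ : ℝ → (Fin n → ℝ) → (Fin n → ℝ)} (hψ : FlowProps f K ψ) {β : ℝ} (hβ : 0 < β)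
    {u : (Fin n → ℝ) → ℝ} (hu : Continuous u) {C : ℝ} (hC : ∀ x, |u x| ≤ C) :
    Continuous (resolv β ψ u) := by
  have := isFinite_discM hβ
  refine continuous_of_dominated (bound := fun _ => C) ?_ ?_ (integrable_const _) ?_
  · intro x
    exact (hu.comp (hψ.cont.comp (Continuous.prodMk_left x))).aestronglyMeasurable
  · intro x
    exact Filter.Eventually.of_forall (fun t => hC _)
  · refine Filter.Eventually.of_forall (fun t => ?_)
    exact hu.comp (hψ.cont.comp (Continuous.prodMk_right t))

theorem resolv_bdd {X : Type*} {ψ : ℝ → X → X} {β : ℝ} (hβ : 0 < β)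
    {u : X → ℝ} {C : ℝ} (hC : ∀ x, |u x| ≤ C) (x : X) :
    |resolv β ψ u x| ≤ C * (discM β).real univ := by
  have := isFinite_discM hβ
  exact norm_integral_le_of_norm_le_const (f := fun t => u (ψ t x)) (C := C)
    (Filter.Eventually.of_forall (fun t => hC _))

theorem resolv_dyn {n : ℕ} {f : (Fin n → ℝ) → (Fin n → ℝ)} {K : NNReal}
    {ψ : ℝ → (Fin n → ℝ) → (Fin n → ℝ)} (hψ : FlowProps f K ψ) {β : ℝ} (hβ : 0 < β)
    {u : (Fin n → ℝ) → ℝ} (hu : Continuous u) {C : ℝ} (hC : ∀ x, |u x| ≤ C)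
    (T : ℝ) (hT : 0 ≤ T) (x : Fin n → ℝ) :
    resolv β ψ u x = (∫ t in (0:ℝ)..T, Real.exp (-β * t) * u (ψ t x)) +
      Real.exp (-β * T) * resolv β ψ u (ψ T x) := by
  have hcx : Continuous (fun t => Real.exp (-β * t) * u (ψ t x)) := by
    have h1 := hu.comp (hψ.cont.comp (Continuous.prodMk_left x))
    exact (by fun_prop : Continuous fun t => Real.exp (-β * t)).mul h1
  have hIntg : ∀ a : ℝ, IntegrableOn (fun t => Real.exp (-β * t) * u (ψ t x)) (Ioi a) := by
    intro a
    refine Integrable.mono' (((integrableOn_exp_mul_Ioi (a := -β) (by linarith) a)).mul_const C)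
      hcx.aestronglyMeasurable (Filter.Eventually.of_forall (fun t => ?_))
    rw [norm_mul, Real.norm_eq_abs, Real.norm_eq_abs, abs_of_pos (Real.exp_pos _)]
    gcongr
    exact hC _
  simp only [resolv, integral_discM, integral_Ici_eq_integral_Ioi]
  rw [← intervalIntegral.integral_interval_add_Ioi (hIntg 0) (hIntg T)]
  congr 1
  rw [← integral_const_mul]
  have := (measurePreserving_add_right volume T).setIntegral_preimage_emb
    (measurableEmbedding_addRight T) (fun t => Real.exp (-β * t) * u (ψ t x)) (Ioi T)
  rw [preimage_add_const_Ioi, sub_self] at this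
  rw [← this]
  refine setIntegral_congr_fun measurableSet_Ioi (fun t ht => ?_)
  rw [hψ.add t T (le_of_lt ht) hT, ← mul_assoc, ← Real.exp_add]
  congr 2
  ring

theorem resolv_lip {n : ℕ} {f : (Fin n → ℝ) → (Fin n → ℝ)} {K : NNReal}
    {ψ : ℝ → (Fin n → ℝ) → (Fin n → ℝ)} (hψ : FlowProps f K ψ)
    (β : ℝ) (hβ : 0 < β)
    (μ μ₀ μT : Measure (Fin n → ℝ))
    [IsFiniteMeasure μ] [IsFiniteMeasure μ₀] [IsFiniteMeasure μT]
    (hμc : ∃ C : Set (Fin n → ℝ), IsCompact C ∧ μ Cᶜ = 0)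
    (hμ₀c : ∃ C : Set (Fin n → ℝ), IsCompact C ∧ μ₀ Cᶜ = 0)
    (hμTc : ∃ C : Set (Fin n → ℝ), IsCompact C ∧ μT Cᶜ = 0)
    (hLiouville : ∀ v : (Fin n → ℝ) → ℝ, ContDiff ℝ 1 v →
      ∫ x, v x ∂μT = (∫ x, v x ∂μ₀) + ∫ x, (fderiv ℝ v x (f x) - β * v x) ∂μ)
    (u : (Fin n → ℝ) → ℝ) (L : NNReal) (hu : LipschitzWith L u) (C : ℝ) (hC : ∀ x, |u x| ≤ C) :
    ∫ x, u x ∂μ + ∫ x, resolv β ψ u x ∂μT = ∫ x, resolv β ψ u x ∂μ₀ := by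
  have hRc := resolv_cont hψ hβ hu.continuous hC
  have hψT : ∀ T, Continuous (ψ T) := fun T => hψ.cont.comp (Continuous.prodMk_right T)
  set B := ∫ x, resolv β ψ u x ∂μT - ∫ x, resolv β ψ u x ∂μ₀ + ∫ x, u x ∂μ with hB
  have key : ∀ T : ℝ, 0 ≤ T → |B| ≤ Real.exp (-β * T) *
      ((C * (discM β).real univ) * μT.real univ + (C * (discM β).real univ) * μ₀.real univ
        + C * μ.real univ) := by
    intro T hT
    have e := liouville_finite hψ β hβ μ μ₀ μT hμc hμ₀c hμTc hLiouville u L hu T hT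
    have hw : ∀ x, (∫ t in (0:ℝ)..T, Real.exp (-β * t) * u (ψ t x)) =
        resolv β ψ u x - Real.exp (-β * T) * resolv β ψ u (ψ T x) := fun x => by
      rw [resolv_dyn hψ hβ hu.continuous hC T hT x]; ring
    simp_rw [hw] at e
    have hR2 : Continuous (fun x => Real.exp (-β * T) * resolv β ψ u (ψ T x)) :=
      continuous_const.mul (hRc.comp (hψT T))
    have hu2 : Continuous (fun x => Real.exp (-β * T) * u (ψ T x)) :=
      continuous_const.mul (hu.continuous.comp (hψT T))
    rw [integral_sub (integrable_of_cpt hμTc hRc)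
      (integrable_of_cpt hμTc hR2),
      integral_sub (integrable_of_cpt hμ₀c hRc)
      (integrable_of_cpt hμ₀c hR2),
      integral_sub
      (integrable_of_cpt hμc hu2)
      (integrable_of_cpt hμc hu.continuous), integral_const_mul, integral_const_mul,
      integral_const_mul] at e
    have b1 := norm_integral_le_of_norm_le_const (μ := μT) (f := fun x => resolv β ψ u (ψ T x))
      (C := C * (discM β).real univ) (Filter.Eventually.of_forall (fun x => resolv_bdd (ψ := ψ) hβ hC (ψ T x)))
    have b2 := norm_integral_le_of_norm_le_const (μ := μ₀) (f := fun x => resolv β ψ u (ψ T x))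
      (C := C * (discM β).real univ) (Filter.Eventually.of_forall (fun x => resolv_bdd (ψ := ψ) hβ hC (ψ T x)))
    have b3 := norm_integral_le_of_norm_le_const (μ := μ) (f := fun x => u (ψ T x)) (C := C)
      (Filter.Eventually.of_forall (fun x => hC (ψ T x)))
    have hBe : B = Real.exp (-β * T) * (∫ x, resolv β ψ u (ψ T x) ∂μT
      - ∫ x, resolv β ψ u (ψ T x) ∂μ₀ + ∫ x, u (ψ T x) ∂μ) := by
      rw [hB]; linarith
    rw [hBe, abs_mul, abs_of_pos (Real.exp_pos _)]
    gcongr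
    rw [Real.norm_eq_abs] at b1 b2 b3
    refine (abs_add_le _ _).trans (add_le_add ((abs_sub _ _).trans (add_le_add b1 b2)) b3)
  have hlim : Filter.Tendsto (fun T : ℝ => Real.exp (-β * T) *
      ((C * (discM β).real univ) * μT.real univ + (C * (discM β).real univ) * μ₀.real univ
        + C * μ.real univ)) Filter.atTop (nhds 0) := by
    have h1 : Filter.Tendsto (fun T : ℝ => Real.exp (-β * T)) Filter.atTop (nhds 0) :=
      Real.tendsto_exp_atBot.comp (Filter.tendsto_id.const_mul_atTop_of_neg (by linarith))
    simpa using h1.mul_const _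
  have : |B| ≤ 0 := ge_of_tendsto hlim
    ((Filter.eventually_ge_atTop 0).mono (fun T hT => key T hT))
  have := abs_nonpos_iff.1 this
  linarith

/-- resolvent adjoint -/
noncomputable def radj {X : Type*} [MeasurableSpace X] (β : ℝ) (ψ : ℝ → X → X) (μ : Measure X) :
    Measure X := (μ.prod (discM β)).map (fun p => ψ p.2 p.1)

theorem integral_radj {n : ℕ} {f : (Fin n → ℝ) → (Fin n → ℝ)} {K : NNReal}
    {ψ : ℝ → (Fin n → ℝ) → (Fin n → ℝ)} (hψ : FlowProps f K ψ) {β : ℝ} (hβ : 0 < β)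
    (μ : Measure (Fin n → ℝ)) [IsFiniteMeasure μ]
    {u : (Fin n → ℝ) → ℝ} (hu : Continuous u) {C : ℝ} (hC : ∀ x, |u x| ≤ C) :
    ∫ x, u x ∂(radj β ψ μ) = ∫ x, resolv β ψ u x ∂μ := by
  have := isFinite_discM hβ
  have hc : Continuous (fun p : (Fin n → ℝ) × ℝ => ψ p.2 p.1) := hψ.cont.comp continuous_swap
  rw [radj, integral_map hc.aemeasurable hu.aestronglyMeasurable, integral_prod]
  · rfl
  · exact Integrable.of_bound (hu.comp hc).aestronglyMeasurable C
      (Filter.Eventually.of_forall (fun t => hC _))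

theorem measure_ext_lip {n : ℕ} (μ ν : Measure (Fin n → ℝ)) [IsFiniteMeasure μ] [IsFiniteMeasure ν]
    (h : ∀ u : (Fin n → ℝ) → ℝ, (∃ L, LipschitzWith L u) → (∃ C, ∀ x, |u x| ≤ C) →
      ∫ x, u x ∂μ = ∫ x, u x ∂ν) : μ = ν := by
  have hcl : ∀ F : Set (Fin n → ℝ), IsClosed F → μ F = ν F := by
    intro F hF
    have hp : ∀ k : ℕ, (0:ℝ) < 1 / ((k:ℝ) + 1) := fun k => by positivity
    have h1 := tendsto_integral_thickenedIndicator_of_isClosed μ hF hp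
      tendsto_one_div_add_atTop_nhds_zero_nat
    have h2 := tendsto_integral_thickenedIndicator_of_isClosed ν hF hp
      tendsto_one_div_add_atTop_nhds_zero_nat
    have h3 : μ.real F = ν.real F := by
      refine tendsto_nhds_unique h1 (h2.congr (fun k => ?_))
      refine (h _ ?_ ⟨1, fun x => ?_⟩).symm
      · exact ⟨_, NNReal.isometry_coe.lipschitz.comp (lipschitzWith_thickenedIndicator (hp k) F)⟩
      · rw [abs_of_nonneg (NNReal.coe_nonneg _)]
        exact_mod_cast thickenedIndicator_le_one (hp k) F x
    exact (measureReal_eq_measureReal_iff).1 h3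
  refine ext_of_generate_finite _ ?_ isPiSystem_isClosed (fun s hs => hcl s hs) 
    (hcl univ isClosed_univ)
  rw [BorelSpace.measurable_eq (α := Fin n → ℝ), borel_eq_generateFrom_isClosed]

theorem resolv_identity {n : ℕ} {f : (Fin n → ℝ) → (Fin n → ℝ)} {K : NNReal}
    {ψ : ℝ → (Fin n → ℝ) → (Fin n → ℝ)} (hψ : FlowProps f K ψ)
    (β : ℝ) (hβ : 0 < β)
    (μ μ₀ μT : Measure (Fin n → ℝ))
    [IsFiniteMeasure μ] [IsFiniteMeasure μ₀] [IsFiniteMeasure μT]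
    (hμc : ∃ C : Set (Fin n → ℝ), IsCompact C ∧ μ Cᶜ = 0)
    (hμ₀c : ∃ C : Set (Fin n → ℝ), IsCompact C ∧ μ₀ Cᶜ = 0)
    (hμTc : ∃ C : Set (Fin n → ℝ), IsCompact C ∧ μT Cᶜ = 0)
    (hLiouville : ∀ v : (Fin n → ℝ) → ℝ, ContDiff ℝ 1 v →
      ∫ x, v x ∂μT = (∫ x, v x ∂μ₀) + ∫ x, (fderiv ℝ v x (f x) - β * v x) ∂μ)
    (u : (Fin n → ℝ) → ℝ) (hu : Continuous u) (C : ℝ) (hC : ∀ x, |u x| ≤ C) :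
    ∫ x, u x ∂μ + ∫ x, resolv β ψ u x ∂μT = ∫ x, resolv β ψ u x ∂μ₀ := by
  have := isFinite_discM hβ
  have : IsFiniteMeasure (radj β ψ μT) := by unfold radj; infer_instance
  have : IsFiniteMeasure (radj β ψ μ₀) := by unfold radj; infer_instance
  have hb : ∀ (m : Measure (Fin n → ℝ)) [IsFiniteMeasure m] (u : (Fin n → ℝ) → ℝ) (C : ℝ), 
    Continuous u → (∀ x, |u x| ≤ C) → Integrable u m := fun m _ u C hu hC =>
      Integrable.of_bound hu.aestronglyMeasurable C (Filter.Eventually.of_forall hC)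
  have : μ + radj β ψ μT = radj β ψ μ₀ := by
    refine measure_ext_lip _ _ ?_
    rintro u ⟨L, hL⟩ ⟨C, hC⟩
    rw [integral_add_measure (hb _ _ C hL.continuous hC) (hb _ _ C hL.continuous hC),
      integral_radj hψ hβ _ hL.continuous hC, integral_radj hψ hβ _ hL.continuous hC]
    exact resolv_lip hψ β hβ μ μ₀ μT hμc hμ₀c hμTc hLiouville u L hL C hC
  rw [← integral_radj hψ hβ _ hu hC, ← integral_radj hψ hβ _ hu hC, ← this, 
    integral_add_measure (hb _ _ C hu hC) (hb _ _ C hu hC)]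

/-- The stopped payoff. -/
noncomputable def stopF {X : Type*} (β : ℝ) (ψ : ℝ → X → X) (v : X → ℝ) (p : X × ENNReal) : ℝ :=
  if p.2 = ⊤ then 0 else Real.exp (-β * p.2.toReal) * v (ψ p.2.toReal p.1)

theorem stopF_bdd {X : Type*} {β : ℝ} (hβ : 0 < β) (ψ : ℝ → X → X) {v : X → ℝ} {C : ℝ}
    (hC : ∀ x, |v x| ≤ C) (p : X × ENNReal) : |stopF β ψ v p| ≤ C := by
  have hC0 : 0 ≤ C := (abs_nonneg _).trans (hC p.1)
  unfold stopF
  split_ifs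
  · simpa using hC0
  · rw [abs_mul, abs_of_pos (Real.exp_pos _)]
    have h1 : Real.exp (-β * p.2.toReal) ≤ 1 := Real.exp_le_one_iff.2 (by
      have := p.2.toReal_nonneg
      nlinarith)
    calc _ ≤ 1 * C := by gcongr; exact hC _
      _ = C := one_mul C

theorem stopF_cont {n : ℕ} {f : (Fin n → ℝ) → (Fin n → ℝ)} {K : NNReal}
    {ψ : ℝ → (Fin n → ℝ) → (Fin n → ℝ)} (hψ : FlowProps f K ψ) {β : ℝ} (hβ : 0 < β)
    {v : (Fin n → ℝ) → ℝ} (hv : Continuous v) {C : ℝ} (hC : ∀ x, |v x| ≤ C) :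
    Continuous (stopF β ψ v) := by
  rw [continuous_iff_continuousAt]
  rintro ⟨x, τ⟩
  have hC0 : 0 ≤ C := (abs_nonneg _).trans (hC x)
  by_cases hτ : τ = ⊤
  · subst hτ
    have h0 : stopF β ψ v (x, ⊤) = 0 := by simp [stopF]
    rw [ContinuousAt, h0, Metric.tendsto_nhds]
    intro ε hε
    have h1 : Filter.Tendsto (fun T : ℝ => Real.exp (-β * T) * C) Filter.atTop (nhds 0) := by
      have h1 : Filter.Tendsto (fun T : ℝ => Real.exp (-β * T)) Filter.atTop (nhds 0) :=
        Real.tendsto_exp_atBot.comp (Filter.tendsto_id.const_mul_atTop_of_neg (by linarith))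
      simpa using h1.mul_const _
    obtain ⟨M, hM⟩ := (h1.eventually (gt_mem_nhds hε)).exists
    have h2 : ∀ᶠ p : (Fin n → ℝ) × ENNReal in nhds (x, ⊤), ENNReal.ofReal M < p.2 :=
      (continuous_snd.tendsto (x, (⊤ : ENNReal))).eventually (lt_mem_nhds ENNReal.ofReal_lt_top)
    filter_upwards [h2] with p hp
    rw [dist_zero_right, Real.norm_eq_abs]
    unfold stopF
    split_ifs with h
    · simpa using hε
    · rw [abs_mul, abs_of_pos (Real.exp_pos _)]
      have h3 : M < p.2.toReal := by
        by_contra hcon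
        have h5 := ENNReal.ofReal_le_ofReal (not_lt.1 hcon)
        rw [ENNReal.ofReal_toReal h] at h5
        exact absurd hp (not_lt.2 h5)
      refine lt_of_le_of_lt ?_ hM
      have h4 : Real.exp (-β * p.2.toReal) ≤ Real.exp (-β * M) :=
        Real.exp_le_exp.2 (by nlinarith)
      gcongr
      exact hC _
  · have h2 : ∀ᶠ p : (Fin n → ℝ) × ENNReal in nhds (x, τ), p.2 < ⊤ :=
      (continuous_snd.tendsto (x, τ)).eventually (gt_mem_nhds (lt_top_iff_ne_top.2 hτ))
    have h3 : ContinuousAt (fun p : (Fin n → ℝ) × ENNReal => p.2.toReal) (x, τ) :=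
      (ENNReal.tendsto_toReal hτ).comp (continuous_snd.tendsto (x, τ))
    have h4 : ContinuousAt (fun p : (Fin n → ℝ) × ENNReal =>
        Real.exp (-β * p.2.toReal) * v (ψ p.2.toReal p.1)) (x, τ) := by
      have h5 : ContinuousAt (fun p : (Fin n → ℝ) × ENNReal => (p.2.toReal, p.1)) (x, τ) :=
        h3.prodMk continuous_fst.continuousAt
      have h6 : Continuous (fun q : ℝ × (Fin n → ℝ) => Real.exp (-β * q.1) * v (ψ q.1 q.2)) :=
        (by fun_prop : Continuous (fun q : ℝ × (Fin n → ℝ) => Real.exp (-β * q.1))).mul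
          (hv.comp hψ.cont)
      exact ContinuousAt.comp (f := fun p : (Fin n → ℝ) × ENNReal => (p.2.toReal, p.1))
        (x := (x, τ)) h6.continuousAt h5
    refine h4.congr ?_
    filter_upwards [h2] with p hp
    simp [stopF, hp.ne]

theorem sup_bddAbove {X : Type*} [TopologicalSpace X] {F : X × ENNReal → ℝ} (hF : Continuous F)
    (x : X) : BddAbove (range fun τ => F (x, τ)) :=
  (isCompact_range (hF.comp (Continuous.prodMk_right x))).bddAbove

theorem sup_cont {X : Type*} [TopologicalSpace X] {F : X × ENNReal → ℝ} (hF : Continuous F) :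
    Continuous (fun x => ⨆ τ, F (x, τ)) := by
  have := (isCompact_univ (X := ENNReal)).continuous_sSup (f := fun x τ => F (x, τ)) (by exact hF)
  simpa [image_univ, sSup_range] using this

theorem ae_discM (β : ℝ) : ∀ᵐ t ∂(discM β), 0 ≤ t :=
  (withDensity_absolutelyContinuous _ _).ae_le (ae_restrict_mem measurableSet_Ici)

theorem main_ineq {n : ℕ} {f : (Fin n → ℝ) → (Fin n → ℝ)} {K : NNReal}
    {ψ : ℝ → (Fin n → ℝ) → (Fin n → ℝ)} (hψ : FlowProps f K ψ)
    (β : ℝ) (hβ : 0 < β)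
    (μ μ₀ μT : Measure (Fin n → ℝ))
    [IsFiniteMeasure μ] [IsFiniteMeasure μ₀] [IsFiniteMeasure μT]
    (hμ₀c : ∃ C : Set (Fin n → ℝ), IsCompact C ∧ μ₀ Cᶜ = 0)
    (hμTc : ∃ C : Set (Fin n → ℝ), IsCompact C ∧ μT Cᶜ = 0)
    (hR : ∀ (u : (Fin n → ℝ) → ℝ) (_ : Continuous u) (C : ℝ) (_ : ∀ x, |u x| ≤ C),
      ∫ x, u x ∂μ + ∫ x, resolv β ψ u x ∂μT = ∫ x, resolv β ψ u x ∂μ₀)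
    (v : (Fin n → ℝ) → ℝ) (hv : Continuous v) (C : ℝ) (hC : ∀ x, |v x| ≤ C) :
    ∫ x, v x ∂μT ≤ ∫ x, (⨆ τ, stopF β ψ v (x, τ)) ∂μ₀ := by
  have hFc := stopF_cont hψ hβ hv hC
  set V : (Fin n → ℝ) → ℝ := fun x => ⨆ τ, stopF β ψ v (x, τ) with hV
  have hVc : Continuous V := sup_cont hFc
  have hle : ∀ x τ, stopF β ψ v (x, τ) ≤ V x := fun x τ => le_ciSup (sup_bddAbove hFc x) τ
  have hV0 : ∀ x, 0 ≤ V x := fun x => by simpa [stopF] using hle x ⊤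
  have hVv : ∀ x, v x ≤ V x := fun x => by simpa [stopF, hψ.zero] using hle x 0
  have hVC : ∀ x, V x ≤ C := fun x => ciSup_le (fun τ => (abs_le.1 (stopF_bdd hβ ψ hC _)).2)
  have hVabs : ∀ x, |V x| ≤ C := fun x => by rw [abs_of_nonneg (hV0 x)]; exact hVC x
  have hexc : ∀ h, 0 ≤ h → ∀ x, Real.exp (-β * h) * V (ψ h x) ≤ V x := by
    intro h hh x
    rw [hV]
    simp only
    rw [Real.mul_iSup_of_nonneg (Real.exp_pos _).le]
    refine ciSup_le (fun τ => ?_)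
    by_cases hτ : τ = ⊤
    · have h1 : stopF β ψ v (ψ h x, τ) = 0 := by simp [stopF, hτ]
      rw [h1, mul_zero]
      exact hV0 x
    · refine le_trans (le_of_eq ?_) (hle x (ENNReal.ofReal h + τ))
      have h1 : ENNReal.ofReal h + τ ≠ ⊤ := by simp [hτ]
      simp only [stopF, hτ, h1, if_false]
      rw [ENNReal.toReal_add ENNReal.ofReal_ne_top hτ, ENNReal.toReal_ofReal hh, add_comm h,
        hψ.add _ _ ENNReal.toReal_nonneg hh, ← mul_assoc, ← Real.exp_add]
      congr 2
      ring
  have hψT : ∀ T, Continuous (ψ T) := fun T => hψ.cont.comp (Continuous.prodMk_right T)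
  have key : ∀ h, 0 < h → Real.exp (-β * h) * ∫ x, v (ψ h x) ∂μT ≤ ∫ x, V x ∂μ₀ := by
    intro h hh
    set u : (Fin n → ℝ) → ℝ := fun x => V x - Real.exp (-β * h) * V (ψ h x) with hu
    have huc : Continuous u := hVc.sub (continuous_const.mul (hVc.comp (hψT h)))
    have hu0 : ∀ x, 0 ≤ u x := fun x => sub_nonneg.2 (hexc h hh.le x)
    have huC : ∀ x, |u x| ≤ C := fun x => by
      rw [abs_of_nonneg (hu0 x)]
      have := mul_nonneg (Real.exp_pos (-β * h)).le (hV0 (ψ h x))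
      simp only [hu]
      linarith [hVC x]
    have hid := hR u huc C huC
    have hRu : ∀ x, resolv β ψ u x = ∫ t in (0:ℝ)..h, Real.exp (-β * t) * V (ψ t x) := by
      intro x
      have hfin := isFinite_discM hβ
      have e1 := resolv_dyn hψ hβ hVc hVabs h hh.le x
      have hcx : Continuous (fun t => V (ψ t x)) := hVc.comp (hψ.cont.comp (Continuous.prodMk_left x))
      have hcx2 : Continuous (fun t => Real.exp (-β * h) * V (ψ t (ψ h x))) :=
        continuous_const.mul (hVc.comp (hψ.cont.comp (Continuous.prodMk_left (ψ h x))))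
      have e2 : resolv β ψ u x = ∫ t, (V (ψ t x) - Real.exp (-β * h) * V (ψ t (ψ h x))) ∂(discM β) := by
        refine integral_congr_ae ?_
        filter_upwards [ae_discM β] with t ht
        simp only [hu]
        rw [← hψ.add h t hh.le ht, ← hψ.add t h ht hh.le, add_comm]
      have e3 : ∫ t, (V (ψ t x) - Real.exp (-β * h) * V (ψ t (ψ h x))) ∂(discM β) =
          resolv β ψ V x - Real.exp (-β * h) * resolv β ψ V (ψ h x) := by
        rw [integral_sub, integral_const_mul]
        · rfl
        · exact Integrable.of_bound hcx.aestronglyMeasurable C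
            (Filter.Eventually.of_forall fun t => hVabs _)
        · exact (Integrable.of_bound (hVc.comp (hψ.cont.comp
            (Continuous.prodMk_left (ψ h x)))).aestronglyMeasurable C
            (Filter.Eventually.of_forall fun t => hVabs _)).const_mul _
      rw [e2, e3, e1]; ring
    have hRuc : Continuous (resolv β ψ u) := resolv_cont hψ hβ huc huC
    have hcx : ∀ x, Continuous (fun t => Real.exp (-β * t) * V (ψ t x)) := fun x =>
      (by fun_prop : Continuous fun t => Real.exp (-β * t)).mul
        (hVc.comp (hψ.cont.comp (Continuous.prodMk_left x)))
    have hup : ∀ x, resolv β ψ u x ≤ h * V x := by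
      intro x
      rw [hRu]
      have := intervalIntegral.integral_mono_on (μ := volume) hh.le ((hcx x).intervalIntegrable 0 h)
        (intervalIntegrable_const (c := V x)) (fun t ht => hexc t ht.1 x)
      simpa using this
    have hlow : ∀ x, h * (Real.exp (-β * h) * v (ψ h x)) ≤ resolv β ψ u x := by
      intro x
      rw [hRu]
      have := intervalIntegral.integral_mono_on (μ := volume) hh.le
        (intervalIntegrable_const (c := Real.exp (-β * h) * v (ψ h x)))
        ((hcx x).intervalIntegrable 0 h)
        (fun t ht => by
          have h1 := hexc (h - t) (by linarith [ht.2]) (ψ t x)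
          rw [← hψ.add (h - t) t (by linarith [ht.2]) ht.1, sub_add_cancel] at h1
          calc Real.exp (-β * h) * v (ψ h x) ≤ Real.exp (-β * h) * V (ψ h x) := by
                gcongr; exact hVv _
            _ = Real.exp (-β * t) * (Real.exp (-β * (h - t)) * V (ψ h x)) := by
                rw [← mul_assoc, ← Real.exp_add]; congr 2; ring
            _ ≤ _ := by gcongr)
      rw [intervalIntegral.integral_const, smul_eq_mul, sub_zero] at this
      exact this
    have i1 : ∫ x, resolv β ψ u x ∂μ₀ ≤ ∫ x, h * V x ∂μ₀ :=
      integral_mono (integrable_of_cpt hμ₀c hRuc)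
        (integrable_of_cpt hμ₀c (continuous_const.mul hVc)) hup
    have i2 : ∫ x, h * (Real.exp (-β * h) * v (ψ h x)) ∂μT ≤ ∫ x, resolv β ψ u x ∂μT :=
      integral_mono (integrable_of_cpt hμTc
        (continuous_const.mul (continuous_const.mul (hv.comp (hψT h)))))
        (integrable_of_cpt hμTc hRuc) hlow
    have i3 : 0 ≤ ∫ x, u x ∂μ := integral_nonneg hu0
    rw [integral_const_mul] at i1
    rw [integral_const_mul, integral_const_mul] at i2
    exact le_of_mul_le_mul_left (by linarith) hh
  have hc : Continuous (fun h : ℝ => Real.exp (-β * h) * ∫ x, v (ψ h x) ∂μT) := by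
    have h1 : Continuous (fun h : ℝ => ∫ x, v (ψ h x) ∂μT) := by
      refine continuous_of_dominated (bound := fun _ => C) ?_ ?_ (integrable_const _) ?_
      · exact fun h => (hv.comp (hψT h)).aestronglyMeasurable
      · exact fun h => Filter.Eventually.of_forall fun x => hC _
      · exact Filter.Eventually.of_forall fun x =>
          hv.comp (hψ.cont.comp (Continuous.prodMk_left x))
    exact (by fun_prop : Continuous fun t => Real.exp (-β * t)).mul h1
  have hl := (hc.tendsto 0).mono_left (nhdsWithin_le_nhds (s := Ioi 0))
  simp only [mul_zero, Real.exp_zero, one_mul, hψ.zero] at hl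
  exact le_of_tendsto hl (by filter_upwards [self_mem_nhdsWithin] with h hh using key h hh)

open scoped CompactlySupported in
/-- Hahn-Banach and Riesz-Markov: existence of the coupling. -/
theorem exists_coupling {n : ℕ} {f : (Fin n → ℝ) → (Fin n → ℝ)} {K : NNReal}
    {ψ : ℝ → (Fin n → ℝ) → (Fin n → ℝ)} (hψ : FlowProps f K ψ)
    (β : ℝ) (hβ : 0 < β)
    (μ₀ μT : Measure (Fin n → ℝ))
    [IsFiniteMeasure μ₀] [IsFiniteMeasure μT]
    (hμ₀c : ∃ C : Set (Fin n → ℝ), IsCompact C ∧ μ₀ Cᶜ = 0)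
    (hI : ∀ (v : (Fin n → ℝ) → ℝ) (_ : Continuous v) (C : ℝ) (_ : ∀ x, |v x| ≤ C),
      ∫ x, v x ∂μT ≤ ∫ x, (⨆ τ, stopF β ψ v (x, τ)) ∂μ₀) :
    ∃ γ : Measure ((Fin n → ℝ) × ENNReal), γ.fst = μ₀ ∧
      ∀ (v : (Fin n → ℝ) → ℝ) (_ : Continuous v) (C : ℝ) (_ : ∀ x, |v x| ≤ C),
        ∫ x, v x ∂μT = ∫ p, stopF β ψ v p ∂γ := by
  obtain ⟨C₀, hC₀, hC₀0⟩ := hμ₀c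
  have hμ₀c : ∃ C : Set (Fin n → ℝ), IsCompact C ∧ μ₀ Cᶜ = 0 := ⟨C₀, hC₀, hC₀0⟩
  have hae : ∀ᵐ x ∂μ₀, x ∈ C₀ := by rw [ae_iff]; exact hC₀0
  obtain ⟨χ, hχ1, -, hχc, hχ01⟩ := exists_continuous_one_zero_of_isCompact hC₀ isClosed_empty
    (disjoint_empty C₀)
  -- lifting compactly supported functions
  have hcs : ∀ (a : (Fin n → ℝ) → ℝ) (F : (Fin n → ℝ) × ENNReal → ℝ), HasCompactSupport a →
      HasCompactSupport (fun p : (Fin n → ℝ) × ENNReal => a p.1 * F p) := by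
    intro a F ha
    refine HasCompactSupport.intro (ha.isCompact.prod isCompact_univ) (fun p hp => ?_)
    have : p.1 ∉ tsupport a := fun h => hp ⟨h, mem_univ _⟩
    simp [image_eq_zero_of_notMem_tsupport this]
  have hvb : ∀ v : BoundedContinuousFunction (Fin n → ℝ) ℝ, ∀ x, |v x| ≤ ‖v‖ :=
    fun v x => v.norm_coe_le_norm x
  have hFc : ∀ v : BoundedContinuousFunction (Fin n → ℝ) ℝ, Continuous (stopF β ψ v) :=
    fun v => stopF_cont hψ hβ v.continuous (hvb v)
  let A : BoundedContinuousFunction (Fin n → ℝ) ℝ →ₗ[ℝ] C_c((Fin n → ℝ) × ENNReal, ℝ) :=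
    { toFun := fun v => ⟨⟨fun p => χ p.1 * stopF β ψ v p,
        (χ.continuous.comp continuous_fst).mul (hFc v)⟩, hcs χ _ hχc⟩
      map_add' := by
        intro v w
        ext p
        simp only [CompactlySupportedContinuousMap.coe_mk, ContinuousMap.coe_mk,
          CompactlySupportedContinuousMap.coe_add, Pi.add_apply, stopF,
          BoundedContinuousFunction.coe_add]
        split_ifs <;> ring
      map_smul' := by
        intro c v
        ext p
        simp only [CompactlySupportedContinuousMap.coe_mk, ContinuousMap.coe_mk,
          CompactlySupportedContinuousMap.coe_smul, Pi.smul_apply, stopF,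
          BoundedContinuousFunction.coe_smul, smul_eq_mul, RingHom.id_apply]
        split_ifs <;> ring }
  have hAapp : ∀ v p, A v p = χ p.1 * stopF β ψ v p := fun v p => rfl
  let ℓ : BoundedContinuousFunction (Fin n → ℝ) ℝ →ₗ[ℝ] ℝ :=
    { toFun := fun v => ∫ x, v x ∂μT
      map_add' := fun v w => integral_add (v.integrable μT) (w.integrable μT)
      map_smul' := fun c v => integral_const_mul c _ }
  let N : C_c((Fin n → ℝ) × ENNReal, ℝ) → ℝ := fun F => ∫ x, (⨆ τ, F (x, τ)) ∂μ₀
  have hNint : ∀ F : C_c((Fin n → ℝ) × ENNReal, ℝ), Integrable (fun x => ⨆ τ, F (x, τ)) μ₀ :=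
    fun F => integrable_of_cpt hμ₀c (sup_cont F.continuous)
  have hNA : ∀ v, ℓ v ≤ N (A v) := by
    intro v
    refine (hI v v.continuous ‖v‖ (hvb v)).trans (le_of_eq ?_)
    refine integral_congr_ae ?_
    filter_upwards [hae] with x hx
    have : χ x = 1 := hχ1 hx
    simp [hAapp, this]
  have hker : ∀ v w, A v = A w → ℓ v = ℓ w := by
    have h0 : ∀ v w, A v = A w → ℓ v ≤ ℓ w := by
      intro v w hvw
      have h1 := hNA (v - w)
      have h2 : N (A (v - w)) = 0 := by
        rw [map_sub, hvw, sub_self]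
        simp [N]
      rw [h2, map_sub] at h1
      linarith
    exact fun v w hvw => le_antisymm (h0 v w hvw) (h0 w v hvw.symm)
  let s : A.range → BoundedContinuousFunction (Fin n → ℝ) ℝ := fun y =>
    Classical.choose (LinearMap.mem_range.1 y.2)
  have hs' : ∀ y : A.range, A (s y) = y := fun y =>
    Classical.choose_spec (LinearMap.mem_range.1 y.2)
  let ℓs : A.range →ₗ[ℝ] ℝ :=
    { toFun := fun y => ℓ (s y)
      map_add' := fun y z => by
        rw [← map_add]
        refine hker _ _ ?_
        rw [map_add, hs', hs', hs']; rfl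
      map_smul' := fun c y => by
        rw [RingHom.id_apply, ← map_smul]
        refine hker _ _ ?_
        rw [map_smul, hs', hs']; rfl }
  obtain ⟨g, hg1, hg2⟩ := exists_extension_of_le_sublinear
    (⟨A.range, ℓs⟩ : C_c((Fin n → ℝ) × ENNReal, ℝ) →ₗ.[ℝ] ℝ) N
    (by
      intro c hc F
      simp only [N]
      rw [← integral_const_mul]
      congr 1
      ext x
      rw [Real.mul_iSup_of_nonneg hc.le]
      rfl)
    (by
      intro F G
      simp only [N]
      rw [← integral_add (hNint F) (hNint G)]
      refine integral_mono (hNint (F + G)) ((hNint F).add (hNint G)) (fun x => ?_)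
      refine ciSup_le (fun τ => ?_)
      exact add_le_add (le_ciSup (sup_bddAbove F.continuous x) τ)
        (le_ciSup (sup_bddAbove G.continuous x) τ))
    (by
      intro y
      have := hNA (s y)
      rw [hs' y] at this
      exact this)
  have hgA : ∀ v, g (A v) = ℓ v := by
    intro v
    have h1 := hg1 ⟨A v, LinearMap.mem_range_self A v⟩
    have h2 : g (A v) = ℓ (s ⟨A v, LinearMap.mem_range_self A v⟩) := h1
    set w := s ⟨A v, LinearMap.mem_range_self A v⟩ with hw
    have h3 : A w = A v := hs' _
    have N0 : N 0 = 0 := by simp [N]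
    have h4 := hNA (w - v)
    have h5 := hNA (v - w)
    rw [map_sub, map_sub, h3, sub_self, N0] at h4 h5
    linarith
  let Λ : C_c((Fin n → ℝ) × ENNReal, ℝ) →ₚ[ℝ] ℝ := PositiveLinearMap.mk₀ g (by
    intro F hF
    have h1 := hg2 (-F)
    have h2 : N (-F) ≤ 0 := by
      refine integral_nonpos (fun x => ?_)
      refine ciSup_le (fun τ => ?_)
      have : 0 ≤ F (x, τ) := hF (x, τ)
      simpa using this
    rw [map_neg] at h1
    linarith)
  have hΛ : ∀ F, Λ F = g F := fun F => rfl
  let γ := RealRMK.rieszMeasure Λ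
  have hγ : ∀ F : C_c((Fin n → ℝ) × ENNReal, ℝ), ∫ p, F p ∂γ = g F := fun F =>
    RealRMK.integral_rieszMeasure Λ F
  have hfc : IsFiniteMeasureOnCompacts γ.fst := by
    refine ⟨fun C hC => ?_⟩
    rw [Measure.fst_apply hC.measurableSet]
    have : Prod.fst ⁻¹' C = C ×ˢ (univ : Set ENNReal) := by ext p; simp
    rw [this]
    exact (hC.prod isCompact_univ).measure_lt_top
  have hlf : IsLocallyFiniteMeasure γ.fst := inferInstance
  have hfst : γ.fst = μ₀ := by
    refine Measure.ext_of_integral_eq_on_compactlySupported (fun a => ?_)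
    let F : C_c((Fin n → ℝ) × ENNReal, ℝ) := ⟨⟨fun p => a p.1 * 1,
        (a.continuous.comp continuous_fst).mul continuous_const⟩, hcs a _ a.hasCompactSupport⟩
    have hFa : ∀ p, F p = a p.1 := fun p => mul_one _
    have h1 : ∫ x, a x ∂γ.fst = g F := by
      have hac : Continuous (fun x => a x) := a.continuous
      rw [← hγ F, Measure.fst, integral_map (f := fun x => a x) measurable_fst.aemeasurable
        hac.aestronglyMeasurable]
      simp [hFa]
    have h2 := hg2 F
    have h3 := hg2 (-F)
    have h4 : N F = ∫ x, a x ∂μ₀ := by simp [N, hFa]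
    have h5 : N (-F) = - ∫ x, a x ∂μ₀ := by simp [N, hFa, integral_neg]
    rw [map_neg, h5] at h3
    rw [h1]
    linarith
  refine ⟨γ, hfst, fun v hv C hC => ?_⟩
  let v' : BoundedContinuousFunction (Fin n → ℝ) ℝ :=
    BoundedContinuousFunction.ofNormedAddCommGroup v hv C hC
  have h1 : ℓ v' = ∫ x, v x ∂μT := rfl
  rw [← h1, ← hgA v', ← hγ]
  refine integral_congr_ae ?_
  have h2 : ∀ᵐ p ∂γ, p.1 ∈ C₀ := by
    have h3 : ∀ᵐ x ∂γ.fst, x ∈ C₀ := by rw [hfst]; exact hae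
    exact ae_of_ae_map measurable_fst.aemeasurable h3
  filter_upwards [h2] with p hp
  have : χ p.1 = 1 := hχ1 hp
  rw [hAapp, this, one_mul]
  rfl

theorem liouville_superposition {n : ℕ}
    (f : (Fin n → ℝ) → (Fin n → ℝ)) (K : NNReal) (hf : LipschitzWith K f)
    (φ : ℝ → (Fin n → ℝ) → (Fin n → ℝ))
    (hφ0 : ∀ x, φ 0 x = x)
    (hφ : ∀ x, ∀ t ∈ Ici (0:ℝ), HasDerivWithinAt (fun s => φ s x) (f (φ t x)) (Ici 0) t)
    (β : ℝ) (hβ : 0 < β)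
    (μ μ₀ μT : Measure (Fin n → ℝ))
    [IsFiniteMeasure μ] [IsFiniteMeasure μ₀] [IsFiniteMeasure μT]
    (hμc : ∃ C : Set (Fin n → ℝ), IsCompact C ∧ μ Cᶜ = 0)
    (hμ₀c : ∃ C : Set (Fin n → ℝ), IsCompact C ∧ μ₀ Cᶜ = 0)
    (hμTc : ∃ C : Set (Fin n → ℝ), IsCompact C ∧ μT Cᶜ = 0)
    (hLiouville : ∀ v : (Fin n → ℝ) → ℝ, ContDiff ℝ 1 v →
      ∫ x, v x ∂μT = (∫ x, v x ∂μ₀) + ∫ x, (fderiv ℝ v x (f x) - β * v x) ∂μ) :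
    ∃ κ : Kernel (Fin n → ℝ) ENNReal, IsMarkovKernel κ ∧
      ∀ v : (Fin n → ℝ) → ℝ, Continuous v → (∃ C : ℝ, ∀ y, |v y| ≤ C) →
        (∫ x, v x ∂μ =
          ∫ x₀, (∫ τ, (∫ t in {t : ℝ | 0 ≤ t ∧ ENNReal.ofReal t < τ},
            Real.exp (-β * t) * v (φ t x₀)) ∂(κ x₀)) ∂μ₀) ∧
        (∫ x, v x ∂μT =
          ∫ x₀, (∫ τ, (if τ = ⊤ then 0 else
            Real.exp (-β * τ.toReal) * v (φ τ.toReal x₀)) ∂(κ x₀)) ∂μ₀) := by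
  have hψ := flowProps_of f K hf φ hφ0 hφ
  set ψ : ℝ → (Fin n → ℝ) → (Fin n → ℝ) := fun t x => φ (max t 0) x with hψdef
  have hψφ : ∀ t, 0 ≤ t → ∀ x, ψ t x = φ t x := fun t ht x => by simp [hψdef, max_eq_left ht]
  have hR := resolv_identity hψ β hβ μ μ₀ μT hμc hμ₀c hμTc hLiouville
  have hI := main_ineq hψ β hβ μ μ₀ μT hμ₀c hμTc hR
  obtain ⟨γ, hfst, hγ⟩ := exists_coupling hψ β hβ μ₀ μT hμ₀c hI
  have hfin : IsFiniteMeasure γ := by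
    refine ⟨?_⟩
    have : γ univ = μ₀ univ := by rw [← hfst, Measure.fst_univ]
    rw [this]
    exact measure_lt_top _ _
  have hdis : μ₀ ⊗ₘ γ.condKernel = γ := by
    rw [← hfst]; exact γ.disintegrate γ.condKernel
  -- part (ii) in terms of ψ
  have hii : ∀ v : (Fin n → ℝ) → ℝ, Continuous v → ∀ C : ℝ, (∀ y, |v y| ≤ C) →
      ∫ x, v x ∂μT = ∫ x₀, (∫ τ, stopF β ψ v (x₀, τ) ∂(γ.condKernel x₀)) ∂μ₀ := by
    intro v hv C hC
    rw [hγ v hv C hC]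
    have hIntg : Integrable (stopF β ψ v) (μ₀ ⊗ₘ γ.condKernel) :=
      Integrable.of_bound (stopF_cont hψ hβ hv hC).aestronglyMeasurable C
        (Filter.Eventually.of_forall (fun p => stopF_bdd hβ ψ hC p))
    rw [← Measure.integral_compProd hIntg, hdis]
  refine ⟨γ.condKernel, inferInstance, ?_⟩
  rintro v hv ⟨C, hC⟩
  constructor
  · have hRc := resolv_cont hψ hβ hv hC
    have hRb := resolv_bdd (ψ := ψ) hβ hC
    have hpt : ∀ (x : Fin n → ℝ) (τ : ENNReal), (∫ t in {t : ℝ | 0 ≤ t ∧ ENNReal.ofReal t < τ},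
            Real.exp (-β * t) * v (φ t x)) =
          resolv β ψ v x - stopF β ψ (resolv β ψ v) (x, τ) := by
      intro x τ
      by_cases hτ : τ = ⊤
      · subst hτ
        have h1 : {t : ℝ | 0 ≤ t ∧ ENNReal.ofReal t < ⊤} = Ici 0 := by ext t; simp
        rw [h1]
        simp only [stopF, if_true, sub_zero, resolv, integral_discM]
        refine setIntegral_congr_fun measurableSet_Ici (fun t ht => ?_)
        simp only [hψφ t ht x]
      · have h1 : {t : ℝ | 0 ≤ t ∧ ENNReal.ofReal t < τ} = Ico 0 τ.toReal := by
          ext t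
          simp only [mem_ofPred_eq, mem_Ico]
          refine and_congr_right (fun ht => ?_)
          exact ENNReal.ofReal_lt_iff_lt_toReal ht hτ
        rw [h1, integral_Ico_eq_integral_Ioc,
          ← intervalIntegral.integral_of_le ENNReal.toReal_nonneg,
          resolv_dyn hψ hβ hv hC τ.toReal ENNReal.toReal_nonneg x]
        simp only [stopF, hτ, if_false, add_sub_cancel_right]
        refine intervalIntegral.integral_congr (fun t ht => ?_)
        rw [uIcc_of_le ENNReal.toReal_nonneg] at ht
        simp only [hψφ t ht.1 x]
    simp_rw [hpt]
    have hSc := stopF_cont hψ hβ hRc hRb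
    have hSi : ∀ x, Integrable (fun τ => stopF β ψ (resolv β ψ v) (x, τ)) (γ.condKernel x) :=
      fun x => Integrable.of_bound (hSc.comp (Continuous.prodMk_right x)).aestronglyMeasurable _
        (Filter.Eventually.of_forall (fun τ => stopF_bdd hβ ψ hRb _))
    have e1 : ∀ x, ∫ τ, (resolv β ψ v x - stopF β ψ (resolv β ψ v) (x, τ)) ∂(γ.condKernel x) =
        resolv β ψ v x - ∫ τ, stopF β ψ (resolv β ψ v) (x, τ) ∂(γ.condKernel x) := by
      intro x
      rw [integral_sub (integrable_const _) (hSi x)]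
      simp
    simp_rw [e1]
    have hSint : Integrable (stopF β ψ (resolv β ψ v)) (μ₀ ⊗ₘ γ.condKernel) :=
      Integrable.of_bound hSc.aestronglyMeasurable _
        (Filter.Eventually.of_forall (fun p => stopF_bdd hβ ψ hRb p))
    have hSint2 : Integrable (fun x => ∫ τ, stopF β ψ (resolv β ψ v) (x, τ) ∂(γ.condKernel x)) μ₀ :=
      Integrable.integral_compProd (a := ()) hSint
    rw [integral_sub (integrable_of_cpt hμ₀c hRc) hSint2,
      ← hii _ hRc _ hRb]
    linarith [hR v hv C hC]
  · rw [hii v hv C hC]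
    simp only [stopF, hψφ _ ENNReal.toReal_nonneg]
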